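/- Let ε ∈ (0, 0.015) and let κ > 0 satisfy F(κ) ≤ ε; set δ_t = κ√t. Then there exists t₁ > 0 (depending on κ, n, D, ε) such that for all t ∈ (0, t₁): (i) δ_t ∈ (0, Δ) and L_t[ŝ_{t,δ_t}] < ε; and (ii) for every continuous function f: ℝ → ℝ that is differentiable except at finitely many points and satisfies L_t[f] < ε, one has 2(n − 1)Δ/(t(Δ − δ_t)) < (1 + 8√ε) · R[f], where 2(n − 1)Δ/(t(Δ − δ_t)) is the value of the non-smoothness measure R[ŝ_{t,δ_t}] of the smoothed piecewise-linear empirical score function. -/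

import Mathlib

open MeasureTheory Real Set Filter
open scoped ENNReal

/-- Centered Gaussian density with standard deviation `σ`. -/
noncomputable def gaussD (x σ : ℝ) : ℝ :=
  (Real.sqrt (2 * Real.pi) * σ)⁻¹ * Real.exp (-x ^ 2 / (2 * σ ^ 2))

/-- Training points `y_k = 2(k-1)Δ - D`, `Δ = D/(n-1)`. -/
noncomputable def trainPt (n : ℕ) (D : ℝ) (k : ℕ) : ℝ :=
  2 * ((k : ℝ) - 1) * (D / ((n : ℝ) - 1)) - D

/-- Noised empirical density `p_t`. -/
noncomputable def pEmp (n : ℕ) (D t x : ℝ) : ℝ :=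
  (1 / (n : ℝ)) * ∑ k ∈ Finset.Icc 1 n, gaussD (x - trainPt n D k) (Real.sqrt t)

/-- Empirical score function `(d/dx) log p_t`. -/
noncomputable def scoreEmp (n : ℕ) (D t x : ℝ) : ℝ :=
  deriv (fun y => Real.log (pEmp n D t y)) x

/-- Score matching loss `L_t[f]`. -/
noncomputable def scoreLoss (n : ℕ) (D t : ℝ) (f : ℝ → ℝ) : ℝ :=
  t * ∫ x, |f x - scoreEmp n D t x| ^ 2 * pEmp n D t x

/-- `F(κ) = 2 ∫_κ^∞ (u-κ)² p_N(u;1) du`. -/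
noncomputable def Fgauss (κ : ℝ) : ℝ :=
  2 * ∫ u in Set.Ioi κ, (u - κ) ^ 2 * gaussD u 1

/-- The smoothed piecewise-linear empirical score function `ŝ_{t,δ}` (as a predicate
characterizing it by its defining piecewise formulas). -/
def IsShat (n : ℕ) (D t δ : ℝ) (s : ℝ → ℝ) : Prop :=
  (∀ x ≤ trainPt n D 1 + δ, s x = (trainPt n D 1 - x) / t) ∧
  (∀ x, trainPt n D n - δ ≤ x → s x = (trainPt n D n - x) / t) ∧
  (∀ k, 2 ≤ k → k ≤ n - 1 →
    ∀ x ∈ Set.Icc (trainPt n D k - δ) (trainPt n D k + δ),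
      s x = (trainPt n D k - x) / t) ∧
  (∀ k, 1 ≤ k → k ≤ n - 1 →
    ∀ x ∈ Set.Icc (trainPt n D k + δ) (trainPt n D (k + 1) - δ),
      s x = (δ / (D / ((n : ℝ) - 1) - δ)) * (x - (trainPt n D k + D / ((n : ℝ) - 1))) / t)

/-- Non-smoothness measure `R[f]`: the total variation over ℝ of the derivative `f'`
(taken over the set where `f` is differentiable). -/
noncomputable def Rns (f : ℝ → ℝ) : ℝ≥0∞ :=
  eVariationOn (deriv f) {x | DifferentiableAt ℝ f x}


section Gaussian

lemma gaussD_one_eq (u : ℝ) : gaussD u 1 = ProbabilityTheory.gaussianPDFReal 0 1 u := by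
  simp [gaussD, ProbabilityTheory.gaussianPDFReal]

lemma gaussD_pos {σ : ℝ} (hσ : 0 < σ) (x : ℝ) : 0 < gaussD x σ := by
  unfold gaussD; positivity

lemma gaussD_neg (x σ : ℝ) : gaussD (-x) σ = gaussD x σ := by
  simp [gaussD]

lemma gaussD_mul {σ : ℝ} (hσ : 0 < σ) (u : ℝ) : gaussD (σ * u) σ = σ⁻¹ * gaussD u 1 := by
  unfold gaussD
  rw [show -(σ * u) ^ 2 / (2 * σ ^ 2) = -u ^ 2 / (2 * 1 ^ 2) by field_simp]
  field_simp

lemma continuous_gaussD (σ : ℝ) : Continuous (fun x => gaussD x σ) := by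
  unfold gaussD; fun_prop

lemma integrable_gaussD_one : Integrable (fun u => gaussD u 1) := by
  simp_rw [gaussD_one_eq]
  exact ProbabilityTheory.integrable_gaussianPDFReal 0 1

lemma integrable_sq_mul_gaussD : Integrable (fun u => u ^ 2 * gaussD u 1) := by
  have h := (integrable_rpow_mul_exp_neg_mul_sq (b := 1 / 2) (by norm_num) (s := 2)
    (by norm_num)).const_mul (Real.sqrt (2 * Real.pi))⁻¹
  refine h.congr (Eventually.of_forall fun u => ?_)
  simp only [gaussD, Real.rpow_two, mul_one, one_pow]
  rw [show -(1 / 2) * u ^ 2 = -u ^ 2 / 2 by ring]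
  ring

lemma integral_sq_mul_gaussD : ∫ u, u ^ 2 * gaussD u 1 = 1 := by
  have h := ProbabilityTheory.variance_fun_id_gaussianReal (μ := 0) (v := 1)
  rw [ProbabilityTheory.variance_eq_integral (by fun_prop),
    ProbabilityTheory.integral_gaussianReal_eq_integral_smul one_ne_zero] at h
  simpa [gaussD_one_eq, mul_comm] using h

/-- Second moment of the standard Gaussian outside `(-A, A)`. -/
noncomputable def gaussTail (A : ℝ) : ℝ :=
  ∫ u, {u : ℝ | A ≤ |u|}.indicator (fun u => u ^ 2 * gaussD u 1) u

lemma measurableSet_le_abs (A : ℝ) : MeasurableSet {u : ℝ | A ≤ |u|} :=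
  measurableSet_le measurable_const (by fun_prop)

lemma integrable_gaussTail (A : ℝ) :
    Integrable ({u : ℝ | A ≤ |u|}.indicator (fun u => u ^ 2 * gaussD u 1)) :=
  integrable_sq_mul_gaussD.indicator (measurableSet_le_abs A)

lemma tendsto_gaussTail : Tendsto gaussTail atTop (nhds 0) := by
  have h := tendsto_integral_filter_of_dominated_convergence (μ := volume) (l := atTop)
    (F := fun A : ℝ => {u : ℝ | A ≤ |u|}.indicator (fun u => u ^ 2 * gaussD u 1))
    (f := fun _ => (0 : ℝ)) (fun u => u ^ 2 * gaussD u 1)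
    (Eventually.of_forall fun A => (integrable_gaussTail A).aestronglyMeasurable)
    (Eventually.of_forall fun A => Eventually.of_forall fun u => ?_)
    integrable_sq_mul_gaussD (Eventually.of_forall fun u => ?_)
  · rw [integral_zero] at h; exact h
  · have := gaussD_pos one_pos u
    refine (norm_indicator_le_norm_self _ _).trans ?_
    rw [Real.norm_of_nonneg (by positivity)]
  · refine tendsto_const_nhds.congr' ?_
    filter_upwards [eventually_gt_atTop |u|] with A hA
    rw [indicator_of_notMem]
    simpa using hA

lemma integral_gaussD_affine {σ : ℝ} (hσ : 0 < σ) (y : ℝ) (K : ℝ → ℝ) :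
    ∫ x, gaussD (x - y) σ * K x = ∫ u, gaussD u 1 * K (y + σ * u) := by
  have h1 := Measure.integral_comp_mul_left (fun v => gaussD v σ * K (y + v)) σ
  have h2 := integral_add_left_eq_self (μ := volume) (fun x => gaussD (x - y) σ * K x) y
  simp only [add_sub_cancel_left] at h2
  rw [← h2]
  simp only [gaussD_mul hσ, mul_assoc] at h1
  rw [integral_const_mul, abs_of_pos (inv_pos.2 hσ), smul_eq_mul] at h1
  exact (mul_left_cancel₀ (inv_pos.2 hσ).ne' h1).symm

lemma integrable_gaussD_affine {σ : ℝ} (hσ : 0 < σ) (y : ℝ) {K : ℝ → ℝ}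
    (hK : Integrable (fun u => gaussD u 1 * K (y + σ * u))) :
    Integrable (fun x => gaussD (x - y) σ * K x) := by
  have h1 : Integrable (fun v => gaussD v σ * K (y + v)) := by
    rw [← integrable_comp_mul_left_iff _ hσ.ne']
    simp only [gaussD_mul hσ, mul_assoc]
    exact hK.const_mul _
  have h2 := h1.comp_add_left (-y)
  refine h2.congr (Eventually.of_forall fun x => ?_)
  simp only [add_neg_cancel_left]
  rw [neg_add_eq_sub]

lemma integrable_gaussD_mul_hinge (κ : ℝ) :
    Integrable (fun u => gaussD u 1 * (max (u - κ) 0) ^ 2) := by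
  have h := (integrable_sq_mul_gaussD.const_mul 2).add (integrable_gaussD_one.const_mul (2 * κ ^ 2))
  have hg := continuous_gaussD 1
  refine h.mono' (Continuous.aestronglyMeasurable (by fun_prop)) (Eventually.of_forall fun u => ?_)
  have := gaussD_pos one_pos u
  rw [Real.norm_of_nonneg (by positivity)]
  simp only [Pi.add_apply]
  have h1 : max (u - κ) 0 ^ 2 ≤ (u - κ) ^ 2 := by
    rcases max_cases (u - κ) 0 with ⟨h, _⟩ | ⟨h, _⟩ <;> rw [h]
    simpa using sq_nonneg (u - κ)
  nlinarith [mul_nonneg (sq_nonneg (u + κ)) this.le, mul_le_mul_of_nonneg_left h1 this.le]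

lemma integral_gaussD_mul_hinge (κ : ℝ) :
    ∫ u, gaussD u 1 * (max (u - κ) 0) ^ 2 = Fgauss κ / 2 := by
  rw [Fgauss, mul_div_cancel_left₀ _ two_ne_zero, ← integral_indicator measurableSet_Ioi]
  refine integral_congr_ae (Eventually.of_forall fun u => ?_)
  by_cases hu : κ < u
  · simp only [indicator_of_mem (mem_Ioi.2 hu), max_eq_left (sub_pos.2 hu).le]
    ring
  · simp [indicator_of_notMem (show u ∉ Ioi κ from hu), max_eq_right (sub_nonpos.2 (not_lt.1 hu))]

end Gaussian

section Variation

lemma deriv_bounded_of_variation {f : ℝ → ℝ}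
    (hfin : {x | ¬ DifferentiableAt ℝ f x}.Finite) (hR : Rns f ≠ ⊤) :
    ∃ K, ∀ x, |deriv f x| ≤ K := by
  obtain ⟨x₀, hx₀⟩ : ∃ x₀, DifferentiableAt ℝ f x₀ := by
    by_contra! h
    exact Set.infinite_univ (by simpa [h] using hfin)
  refine ⟨|deriv f x₀| + (Rns f).toReal, fun x => ?_⟩
  by_cases hx : DifferentiableAt ℝ f x
  · have h := eVariationOn.edist_le (deriv f) (s := {x | DifferentiableAt ℝ f x}) hx hx₀
    have h2 : dist (deriv f x) (deriv f x₀) ≤ (Rns f).toReal := by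
      rw [dist_edist]; exact ENNReal.toReal_mono hR h
    rw [Real.dist_eq] at h2
    have := abs_sub_abs_le_abs_sub (deriv f x) (deriv f x₀)
    linarith
  · rw [deriv_zero_of_not_differentiableAt hx, abs_zero]
    positivity

lemma integral_deriv_eq_sub_of_bounded {f : ℝ → ℝ} (hf : Continuous f)
    (hfin : {x | ¬ DifferentiableAt ℝ f x}.Finite) {K : ℝ} (hK : ∀ x, |deriv f x| ≤ K)
    (a b : ℝ) :
    IntervalIntegrable (deriv f) volume a b ∧ ∫ x in a..b, deriv f x = f b - f a := by
  have hi : IntervalIntegrable (deriv f) volume a b := by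
    refine (intervalIntegrable_const (c := K)).mono_fun
      (measurable_deriv f).aestronglyMeasurable (Eventually.of_forall fun x => ?_)
    exact (hK x).trans (le_abs_self K)
  refine ⟨hi, integral_eq_of_hasDerivAt_off_countable f _ hfin.countable hf.continuousOn
    (fun x hx => ?_) hi⟩
  have := hx.2
  simp only [mem_ofPred_eq, not_not] at this
  exact this.hasDerivAt

lemma mul_sub_le_of_le_deriv {f : ℝ → ℝ} (hf : Continuous f)
    (hfin : {x | ¬ DifferentiableAt ℝ f x}.Finite) {K : ℝ} (hK : ∀ x, |deriv f x| ≤ K)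
    {a b m : ℝ} (hab : a ≤ b)
    (hm : ∀ c ∈ Ioo a b, DifferentiableAt ℝ f c → m ≤ deriv f c) :
    m * (b - a) ≤ f b - f a := by
  obtain ⟨hi, he⟩ := integral_deriv_eq_sub_of_bounded hf hfin hK a b
  rw [← he]
  have h : ∫ _ in a..b, m = m * (b - a) := by simp [mul_comm]
  rw [← h]
  refine intervalIntegral.integral_mono_ae_restrict hab intervalIntegrable_const hi ?_
  have h1 : ∀ᵐ x : ℝ, x ∉ ({x | ¬ DifferentiableAt ℝ f x} ∪ {a, b} : Set ℝ) :=
    (hfin.union (by simp)).countable.ae_notMem _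
  filter_upwards [ae_restrict_of_ae h1, ae_restrict_mem measurableSet_Icc] with x hx hx2
  simp only [mem_union, mem_ofPred_eq, mem_insert_iff, mem_singleton_iff, not_or, not_not] at hx
  exact hm x ⟨lt_of_le_of_ne hx2.1 (Ne.symm hx.2.1), lt_of_le_of_ne hx2.2 hx.2.2⟩ hx.1

lemma sub_le_mul_of_deriv_le {f : ℝ → ℝ} (hf : Continuous f)
    (hfin : {x | ¬ DifferentiableAt ℝ f x}.Finite) {K : ℝ} (hK : ∀ x, |deriv f x| ≤ K)
    {a b m : ℝ} (hab : a ≤ b)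
    (hm : ∀ c ∈ Ioo a b, DifferentiableAt ℝ f c → deriv f c ≤ m) :
    f b - f a ≤ m * (b - a) := by
  have hset : {x | ¬ DifferentiableAt ℝ (-f) x} = {x | ¬ DifferentiableAt ℝ f x} := by
    ext x; simp
  have hd : ∀ x, deriv (-f) x = - deriv f x := fun x => by
    simp [Pi.neg_def]
  have := mul_sub_le_of_le_deriv hf.neg (hset ▸ hfin) (K := K)
    (fun x => by rw [hd, abs_neg]; exact hK x) (m := -m) hab
    (fun c hc hdc => by rw [hd]; exact neg_le_neg (hm c hc (by simpa using hdc)))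
  simp only [Pi.neg_apply] at this
  linarith

lemma sum_zigzag_le_eVariationOn {g : ℝ → ℝ} {S : Set ℝ} {a b : ℕ → ℝ} {N : ℕ}
    (ha : ∀ i ≤ N, a i ∈ S) (hb : ∀ i < N, b i ∈ S)
    (hab : ∀ i < N, a i ≤ b i) (hba : ∀ i < N, b i ≤ a (i + 1)) :
    ∀ m ≤ N, ENNReal.ofReal (∑ i ∈ Finset.range m,
      ((g (b i) - g (a i)) + (g (b i) - g (a (i + 1))))) ≤ eVariationOn g (S ∩ Iic (a m)) := by
  intro m
  induction m with
  | zero => simp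
  | succ m ih =>
    intro hm
    rw [Finset.sum_range_succ]
    refine ENNReal.ofReal_add_le.trans ?_
    have h1 := hab m hm
    have h2 := hba m hm
    have e1 : ENNReal.ofReal (g (b m) - g (a m)) ≤ eVariationOn g (S ∩ Icc (a m) (b m)) := by
      refine le_trans ?_ (eVariationOn.edist_le g (x := b m) (y := a m)
        ⟨hb m hm, h1, le_rfl⟩ ⟨ha m (by omega), le_rfl, h1⟩)
      rw [edist_dist, Real.dist_eq]
      exact ENNReal.ofReal_le_ofReal (le_abs_self _)
    have e2 : ENNReal.ofReal (g (b m) - g (a (m + 1))) ≤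
        eVariationOn g (S ∩ Icc (b m) (a (m + 1))) := by
      refine le_trans ?_ (eVariationOn.edist_le g (x := b m) (y := a (m + 1))
        ⟨hb m hm, le_rfl, h2⟩ ⟨ha (m + 1) hm, h2, le_rfl⟩)
      rw [edist_dist, Real.dist_eq]
      exact ENNReal.ofReal_le_ofReal (le_abs_self _)
    refine (add_le_add (ih (by omega)) (ENNReal.ofReal_add_le.trans (add_le_add e1 e2))).trans ?_
    rw [← add_assoc]
    refine (add_le_add_left (eVariationOn.add_le_union g ?_) _).trans
      ((eVariationOn.add_le_union g ?_).trans (eVariationOn.mono g ?_))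
    · rintro x ⟨_, hx⟩ y ⟨_, hy⟩
      exact le_trans hx hy.1
    · rintro x (⟨_, hx⟩ | ⟨_, hx⟩) y ⟨_, hy⟩
      · exact (le_trans hx h1).trans hy.1
      · exact hx.2.trans hy.1
    · rintro x ((⟨h, hx⟩ | ⟨h, hx⟩) | ⟨h, hx⟩)
      · exact ⟨h, (le_trans hx h1).trans h2⟩
      · exact ⟨h, hx.2.trans h2⟩
      · exact ⟨h, hx.2⟩

/-- A function taking only one value below `p` and only one value from `p` on has variation
at most the jump. -/
lemma eVariationOn_le_of_step {g : ℝ → ℝ} {T : Set ℝ} {p α β : ℝ}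
    (h₁ : ∀ x ∈ T, x < p → g x = α) (h₂ : ∀ x ∈ T, p ≤ x → g x = β) :
    eVariationOn g T ≤ ENNReal.ofReal |β - α| := by
  have key : ∀ x ∈ T, g x = if x < p then α else β := by
    intro x hx
    split_ifs with h
    · exact h₁ x hx h
    · exact h₂ x hx (not_lt.1 h)
  refine iSup_le fun ⟨m, u, hu, huT⟩ => ?_
  suffices H : ∀ m : ℕ, ∑ i ∈ Finset.range m, edist (g (u (i + 1))) (g (u i)) ≤
      if u 0 < p ∧ p ≤ u m then ENNReal.ofReal |β - α| else 0 by
    refine (H m).trans ?_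
    split_ifs <;> simp
  intro m
  induction m with
  | zero => simp
  | succ m ih =>
    rw [Finset.sum_range_succ, key _ (huT _), key _ (huT _)]
    have h0 := hu (Nat.zero_le m)
    have h1 := hu (Nat.le_succ m)
    refine (add_le_add_left ih _).trans ?_
    rw [edist_dist, Real.dist_eq]
    simp only [Nat.succ_eq_add_one] at h1
    by_cases c1 : u m < p
    · by_cases c2 : u (m + 1) < p
      · simp [c1, c2, not_le.2 c1]
      · simp [c1, c2, not_le.2 c1, not_lt.1 c2, h0.trans_lt c1]
    · have c2 : p ≤ u (m + 1) := (not_lt.1 c1).trans h1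
      simp [c1, not_lt.2 c2, not_lt.1 c1, c2]

lemma deriv_eq_of_eqOn_Icc {s : ℝ → ℝ} {l r p q : ℝ}
    (h : ∀ x ∈ Icc l r, s x = p * x + q) {x : ℝ} (hx : x ∈ Ico l r)
    (hd : DifferentiableAt ℝ s x) : deriv s x = p := by
  have h1 : HasDerivWithinAt s (deriv s x) (Icc x r) x := hd.hasDerivAt.hasDerivWithinAt
  have h2 : HasDerivWithinAt s p (Icc x r) x := by
    have h3 : HasDerivWithinAt (fun x => p * x + q) p (Icc x r) x := by
      simpa using (((hasDerivAt_id x).const_mul p).add_const q).hasDerivWithinAt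
    exact h3.congr (fun y hy => h y ⟨hx.1.trans hy.1, hy.2⟩) (h x ⟨hx.1, hx.2.le⟩)
  exact (uniqueDiffOn_Icc hx.2 x (left_mem_Icc.2 hx.2.le)).eq_deriv _ h1 h2

lemma differentiableAt_of_eqOn_Icc {s : ℝ → ℝ} {l r p q : ℝ}
    (h : ∀ x ∈ Icc l r, s x = p * x + q) {x : ℝ} (hx : x ∈ Ioo l r) :
    DifferentiableAt ℝ s x := by
  have h3 : DifferentiableAt ℝ (fun x => p * x + q) x := by fun_prop
  refine h3.congr_of_eventuallyEq ?_
  filter_upwards [Icc_mem_nhds hx.1 hx.2] with y hy using h y hy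

end Variation

section ScoreMatching

lemma weighted_sq_decomp {ι : Type*} (s : Finset ι) (w v : ι → ℝ) (hS : ∑ j ∈ s, w j ≠ 0)
    (a : ℝ) :
    ∑ j ∈ s, w j * (a - v j) ^ 2 =
      (∑ j ∈ s, w j) * (a - (∑ j ∈ s, w j * v j) / ∑ j ∈ s, w j) ^ 2 +
        ∑ j ∈ s, w j * ((∑ j ∈ s, w j * v j) / (∑ j ∈ s, w j) - v j) ^ 2 := by
  have expand : ∀ b : ℝ, ∑ j ∈ s, w j * (b - v j) ^ 2 =
      (∑ j ∈ s, w j) * b ^ 2 - 2 * b * (∑ j ∈ s, w j * v j) + ∑ j ∈ s, w j * v j ^ 2 := by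
    intro b
    rw [Finset.sum_mul, Finset.mul_sum, ← Finset.sum_sub_distrib, ← Finset.sum_add_distrib]
    exact Finset.sum_congr rfl fun j _ => by ring
  rw [expand, expand]
  field_simp
  ring

lemma trainPt_sub (n : ℕ) (D : ℝ) (j k : ℕ) :
    trainPt n D j - trainPt n D k = 2 * ((j : ℝ) - k) * (D / ((n : ℝ) - 1)) := by
  unfold trainPt; ring

lemma trainPt_mono {n : ℕ} {D : ℝ} (hΔ : 0 < D / ((n : ℝ) - 1)) {j k : ℕ} (h : j ≤ k) :
    trainPt n D j ≤ trainPt n D k := by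
  have h1 := trainPt_sub n D k j
  have h2 : (j : ℝ) ≤ k := by exact_mod_cast h
  have := mul_nonneg (sub_nonneg.2 h2) hΔ.le
  linarith

lemma trainPt_eq_of_abs_sub_lt {n : ℕ} {D : ℝ} (hΔ : 0 < D / ((n : ℝ) - 1)) {j k : ℕ}
    (h : |trainPt n D j - trainPt n D k| < 2 * (D / ((n : ℝ) - 1))) : j = k := by
  rw [trainPt_sub, abs_mul, abs_mul, abs_of_pos hΔ, abs_two] at h
  have h1 : |(j : ℝ) - k| < 1 := by
    by_contra! h1
    nlinarith
  have h2 : |(j : ℤ) - k| < 1 := by exact_mod_cast h1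
  rw [Int.abs_lt_one_iff] at h2
  omega

variable {n : ℕ} {D t : ℝ}

lemma sum_gaussD_pos (hn : 1 ≤ n) (ht : 0 < t) (x : ℝ) :
    0 < ∑ k ∈ Finset.Icc 1 n, gaussD (x - trainPt n D k) (√t) :=
  Finset.sum_pos (fun _ _ => gaussD_pos (Real.sqrt_pos.2 ht) _) ⟨1, by simp [hn]⟩

lemma hasDerivAt_gaussD (ht : 0 < t) (y x : ℝ) :
    HasDerivAt (fun x => gaussD (x - y) (√t)) (gaussD (x - y) (√t) * ((y - x) / t)) x := by
  unfold gaussD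
  rw [Real.sq_sqrt ht.le]
  have h := ((((((hasDerivAt_id x).sub_const y).pow 2).neg).div_const (2 * t)).exp).const_mul
    ((√(2 * Real.pi) * √t)⁻¹)
  refine h.congr_deriv ?_
  simp only [id, Pi.neg_apply, Pi.pow_apply]
  field_simp
  simp
  ring

lemma scoreEmp_eq (hn : 1 ≤ n) (ht : 0 < t) (x : ℝ) :
    scoreEmp n D t x =
      (∑ k ∈ Finset.Icc 1 n, gaussD (x - trainPt n D k) (√t) * ((trainPt n D k - x) / t)) /
        ∑ k ∈ Finset.Icc 1 n, gaussD (x - trainPt n D k) (√t) := by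
  have hS := sum_gaussD_pos (D := D) hn ht x
  have hn' : (0 : ℝ) < n := by exact_mod_cast hn
  have h1 : HasDerivAt (pEmp n D t) ((1 / (n : ℝ)) * ∑ k ∈ Finset.Icc 1 n,
      gaussD (x - trainPt n D k) (√t) * ((trainPt n D k - x) / t)) x :=
    (HasDerivAt.fun_sum fun k _ => hasDerivAt_gaussD ht (trainPt n D k) x).const_mul _
  have h2 := h1.log (by unfold pEmp; positivity)
  rw [scoreEmp, h2.deriv, pEmp, mul_div_mul_left _ _ (by positivity)]

lemma sq_sub_score_mul_pEmp_le (hn : 1 ≤ n) (ht : 0 < t) (a x : ℝ) :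
    |a - scoreEmp n D t x| ^ 2 * pEmp n D t x ≤
      (1 / (n : ℝ)) * ∑ k ∈ Finset.Icc 1 n,
        gaussD (x - trainPt n D k) (√t) * (a - (trainPt n D k - x) / t) ^ 2 := by
  have hS := sum_gaussD_pos (D := D) hn ht x
  rw [weighted_sq_decomp _ _ (fun k => (trainPt n D k - x) / t) hS.ne', ← scoreEmp_eq hn ht,
    sq_abs, pEmp]
  have : 0 ≤ ∑ k ∈ Finset.Icc 1 n, gaussD (x - trainPt n D k) (√t) *
      (scoreEmp n D t x - (trainPt n D k - x) / t) ^ 2 :=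
    Finset.sum_nonneg fun k _ => mul_nonneg (gaussD_pos (Real.sqrt_pos.2 ht) _).le (sq_nonneg _)
  have hn' : (0 : ℝ) ≤ 1 / n := by positivity
  nlinarith [mul_nonneg hn' this]

lemma le_sq_sub_score_mul_pEmp (hn : 1 ≤ n) (hΔ : 0 < D / ((n : ℝ) - 1)) (ht : 0 < t)
    (a x : ℝ) :
    (1 / (n : ℝ)) * ∑ k ∈ Finset.Icc 1 n, gaussD (x - trainPt n D k) (√t) *
        ((a - (trainPt n D k - x) / t) ^ 2 -
          {z : ℝ | D / ((n : ℝ) - 1) ≤ |z|}.indicator (fun z => 4 * (z / t) ^ 2)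
            (x - trainPt n D k)) ≤
      |a - scoreEmp n D t x| ^ 2 * pEmp n D t x := by
  have hS := sum_gaussD_pos (D := D) hn ht x
  set v : ℕ → ℝ := fun k => (trainPt n D k - x) / t with hv
  set w : ℕ → ℝ := fun k => gaussD (x - trainPt n D k) (√t) with hw
  have hw0 : ∀ k, 0 < w k := fun k => gaussD_pos (Real.sqrt_pos.2 ht) _
  obtain ⟨i, hi, hmin⟩ := Finset.exists_min_image (Finset.Icc 1 n)
    (fun k => |x - trainPt n D k|) ⟨1, by simp [hn]⟩
  have h1 := weighted_sq_decomp (Finset.Icc 1 n) w v hS.ne' a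
  have h2 := weighted_sq_decomp (Finset.Icc 1 n) w v hS.ne' (v i)
  have h3 : ∑ k ∈ Finset.Icc 1 n, w k * (v i - v k) ^ 2 ≤ ∑ k ∈ Finset.Icc 1 n, w k *
      {z : ℝ | D / ((n : ℝ) - 1) ≤ |z|}.indicator (fun z => 4 * (z / t) ^ 2)
        (x - trainPt n D k) := by
    refine Finset.sum_le_sum fun k hk => mul_le_mul_of_nonneg_left ?_ (hw0 k).le
    have hk' := hmin k hk
    by_cases hc : D / ((n : ℝ) - 1) ≤ |x - trainPt n D k|
    · rw [indicator_of_mem (by exact hc)]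
      have e : v i - v k = ((x - trainPt n D k) - (x - trainPt n D i)) / t := by
        simp only [hv]; ring
      rw [e, div_pow, div_pow, ← mul_div_assoc]
      gcongr
      have := sq_le_sq.2 hk'
      nlinarith [sq_nonneg ((x - trainPt n D k) + (x - trainPt n D i))]
    · rw [indicator_of_notMem (by exact hc)]
      push Not at hc
      have : i = k := by
        refine trainPt_eq_of_abs_sub_lt hΔ ?_
        have := abs_sub (x - trainPt n D k) (x - trainPt n D i)
        rw [show trainPt n D i - trainPt n D k =
          (x - trainPt n D k) - (x - trainPt n D i) by ring]
        linarith
      simp [this]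
  have h4 : 0 ≤ (∑ k ∈ Finset.Icc 1 n, w k) *
      (v i - (∑ k ∈ Finset.Icc 1 n, w k * v k) / ∑ k ∈ Finset.Icc 1 n, w k) ^ 2 :=
    mul_nonneg hS.le (sq_nonneg _)
  have h5 : ∑ k ∈ Finset.Icc 1 n, w k * ((a - v k) ^ 2 -
      {z : ℝ | D / ((n : ℝ) - 1) ≤ |z|}.indicator (fun z => 4 * (z / t) ^ 2)
        (x - trainPt n D k)) ≤ (∑ k ∈ Finset.Icc 1 n, w k) * (a - scoreEmp n D t x) ^ 2 := by
    simp only [mul_sub, Finset.sum_sub_distrib]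
    rw [scoreEmp_eq hn ht]
    linarith
  rw [sq_abs, pEmp]
  have hn' : (0 : ℝ) ≤ 1 / n := by positivity
  calc _ ≤ (1 / (n : ℝ)) * ((∑ k ∈ Finset.Icc 1 n, w k) * (a - scoreEmp n D t x) ^ 2) :=
        mul_le_mul_of_nonneg_left h5 hn'
    _ = _ := by ring

lemma scoreLoss_le (hn : 1 ≤ n) (ht : 0 < t) {f : ℝ → ℝ} {W : ℕ → ℝ → ℝ}
    (hW : ∀ k ∈ Finset.Icc 1 n, Integrable (fun u => gaussD u 1 * W k u))
    (hf : ∀ k ∈ Finset.Icc 1 n, ∀ u,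
      (√t * f (trainPt n D k + √t * u) + u) ^ 2 ≤ W k u) :
    scoreLoss n D t f ≤ (1 / (n : ℝ)) * ∑ k ∈ Finset.Icc 1 n, ∫ u, gaussD u 1 * W k u := by
  have hσ := Real.sqrt_pos.2 ht
  set V : ℕ → ℝ → ℝ := fun k x => W k ((x - trainPt n D k) / √t) with hV
  have hVW : ∀ k u, V k (trainPt n D k + √t * u) = W k u := by
    intro k u
    simp only [hV, add_sub_cancel_left]
    rw [mul_div_cancel_left₀ _ hσ.ne']
  have hVi : ∀ k ∈ Finset.Icc 1 n,
      Integrable (fun x => gaussD (x - trainPt n D k) (√t) * V k x) := by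
    intro k hk
    refine integrable_gaussD_affine hσ _ ?_
    simpa only [hVW] using hW k hk
  have hVint : ∀ k, ∫ x, gaussD (x - trainPt n D k) (√t) * V k x = ∫ u, gaussD u 1 * W k u := by
    intro k
    rw [integral_gaussD_affine hσ]
    simp only [hVW]
  have hle : ∀ k ∈ Finset.Icc 1 n, ∀ x, t * (f x - (trainPt n D k - x) / t) ^ 2 ≤ V k x := by
    intro k hk x
    have h := hf k hk ((x - trainPt n D k) / √t)
    rw [mul_div_cancel₀ _ hσ.ne', add_sub_cancel] at h
    refine le_trans (le_of_eq ?_) h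
    have h2 : (x - trainPt n D k) / √t = √t * ((x - trainPt n D k) / t) := by
      rw [div_eq_iff hσ.ne', mul_right_comm, Real.mul_self_sqrt ht.le]
      field_simp
    rw [h2, ← mul_add, mul_pow, Real.sq_sqrt ht.le]
    congr 2
    ring
  rw [scoreLoss, ← integral_const_mul]
  calc _ ≤ ∫ x, (1 / (n : ℝ)) * ∑ k ∈ Finset.Icc 1 n,
        gaussD (x - trainPt n D k) (√t) * V k x := by
        refine integral_mono_of_nonneg (Eventually.of_forall fun x => ?_)
          ((integrable_finsetSum _ hVi).const_mul _) (Eventually.of_forall fun x => ?_)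
        · have := (sum_gaussD_pos (D := D) hn ht x).le
          simp only [Pi.zero_apply, pEmp]
          positivity
        · refine (mul_le_mul_of_nonneg_left (sq_sub_score_mul_pEmp_le hn ht (f x) x) ht.le).trans ?_
          rw [mul_left_comm, Finset.mul_sum]
          refine mul_le_mul_of_nonneg_left (Finset.sum_le_sum fun k hk => ?_) (by positivity)
          rw [mul_left_comm]
          exact mul_le_mul_of_nonneg_left (hle k hk x) (gaussD_pos hσ _).le
    _ = _ := by
        rw [integral_const_mul, integral_finsetSum _ hVi]
        simp only [hVint]

lemma integrable_gaussD_mul_sq_of_linear_growth {h : ℝ → ℝ} (hc : Continuous h) {a b : ℝ}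
    (hb : ∀ u, |h u| ≤ a + b * |u|) : Integrable (fun u => gaussD u 1 * h u ^ 2) := by
  have hi := (integrable_gaussD_one.const_mul (2 * a ^ 2)).add
    (integrable_sq_mul_gaussD.const_mul (2 * b ^ 2))
  have hg := continuous_gaussD 1
  refine hi.mono' (Continuous.aestronglyMeasurable (by fun_prop))
    (Eventually.of_forall fun u => ?_)
  have hp := gaussD_pos one_pos u
  rw [Real.norm_of_nonneg (by positivity)]
  have h1 : h u ^ 2 ≤ (a + b * |u|) ^ 2 := by
    rw [← sq_abs]; exact pow_le_pow_left₀ (abs_nonneg _) (hb u) 2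
  have h2 : (a + b * |u|) ^ 2 ≤ 2 * a ^ 2 + 2 * b ^ 2 * u ^ 2 := by
    rw [← sq_abs u]; nlinarith [sq_nonneg (a - b * |u|)]
  simp only [Pi.add_apply]
  nlinarith [mul_le_mul_of_nonneg_left (h1.trans h2) hp.le]

lemma sum_integral_le_scoreLoss (hn : 1 ≤ n) (hΔ : 0 < D / ((n : ℝ) - 1)) (ht : 0 < t)
    {f : ℝ → ℝ} (hfc : Continuous f)
    (hi : ∀ k, Integrable (fun u => gaussD u 1 * (√t * f (trainPt n D k + √t * u) + u) ^ 2)) :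
    (1 / (n : ℝ)) * ∑ k ∈ Finset.Icc 1 n,
        ∫ u, gaussD u 1 * (√t * f (trainPt n D k + √t * u) + u) ^ 2 ≤
      scoreLoss n D t f + 4 * gaussTail (D / ((n : ℝ) - 1) / √t) := by
  have hσ := Real.sqrt_pos.2 ht
  have hn0 : (0 : ℝ) < n := by exact_mod_cast hn
  set Δ := D / ((n : ℝ) - 1) with hΔdef
  set q : ℕ → ℝ → ℝ := fun k x => (f x - (trainPt n D k - x) / t) ^ 2 with hq
  set r : ℕ → ℝ → ℝ := fun k x =>
    {z : ℝ | Δ ≤ |z|}.indicator (fun z => 4 * (z / t) ^ 2) (x - trainPt n D k) with hr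
  have eq : ∀ k u, q k (trainPt n D k + √t * u) =
      t⁻¹ * (√t * f (trainPt n D k + √t * u) + u) ^ 2 := by
    intro k u
    have h2 : (u : ℝ) = √t * (√t * u / t) := by
      rw [← mul_div_assoc, ← mul_assoc, Real.mul_self_sqrt ht.le]; field_simp
    conv_rhs => enter [2, 1, 2]; rw [h2]
    rw [← mul_add, mul_pow, Real.sq_sqrt ht.le, ← mul_assoc, inv_mul_cancel₀ ht.ne', one_mul]
    simp only [hq]
    ring
  have er : ∀ k u, gaussD u 1 * r k (trainPt n D k + √t * u) =
      t⁻¹ * (4 * {u : ℝ | Δ / √t ≤ |u|}.indicator (fun u => u ^ 2 * gaussD u 1) u) := by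
    intro k u
    simp only [hr, add_sub_cancel_left, indicator_apply, mem_ofPred_eq, abs_mul, abs_of_pos hσ,
      div_le_iff₀' hσ]
    split_ifs
    · rw [div_pow, mul_pow, Real.sq_sqrt ht.le]
      field_simp
    · simp
  have hqi : ∀ k, Integrable (fun x => gaussD (x - trainPt n D k) (√t) * q k x) := by
    intro k
    refine integrable_gaussD_affine hσ _ ?_
    simp only [eq, mul_left_comm _ t⁻¹]
    exact (hi k).const_mul _
  have hri : ∀ k, Integrable (fun x => gaussD (x - trainPt n D k) (√t) * r k x) := by
    intro k
    refine integrable_gaussD_affine hσ _ ?_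
    simp only [er]
    exact ((integrable_gaussTail _).const_mul _).const_mul _
  have hL : Integrable (fun x => |f x - scoreEmp n D t x| ^ 2 * pEmp n D t x) := by
    refine ((integrable_finsetSum (Finset.Icc 1 n) fun k _ => hqi k).const_mul
      (1 / (n : ℝ))).mono' ?_ (Eventually.of_forall fun x => ?_)
    · refine Measurable.aestronglyMeasurable ?_
      have h1 : Measurable (scoreEmp n D t) := measurable_deriv _
      have h2 : Continuous (pEmp n D t) := by
        unfold pEmp
        refine continuous_const.mul (continuous_finsetSum _ fun k _ => ?_)
        exact (continuous_gaussD _).comp (by fun_prop)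
      have h3 := h2.measurable
      have h4 := hfc.measurable
      exact (((h4.sub h1).norm).pow_const 2).mul h3
    · rw [Real.norm_of_nonneg]
      · exact sq_sub_score_mul_pEmp_le hn ht (f x) x
      · have := (sum_gaussD_pos (D := D) hn ht x).le
        simp only [pEmp]
        positivity
  have hmono := integral_mono (((integrable_finsetSum (Finset.Icc 1 n)
    fun k _ => (hqi k).sub (hri k))).const_mul (1 / (n : ℝ))) hL (fun x => by
      have := le_sq_sub_score_mul_pEmp (n := n) (D := D) hn hΔ ht (f x) x
      simpa only [mul_sub, Pi.sub_apply] using this)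
  rw [integral_const_mul, integral_finsetSum _ fun k _ => (hqi k).sub (hri k)] at hmono
  have hk : ∀ k, ∫ x, (fun x => gaussD (x - trainPt n D k) (√t) * q k x -
      gaussD (x - trainPt n D k) (√t) * r k x) x = t⁻¹ *
        (∫ u, gaussD u 1 * (√t * f (trainPt n D k + √t * u) + u) ^ 2) -
        t⁻¹ * (4 * gaussTail (Δ / √t)) := by
    intro k
    rw [integral_sub (hqi k) (hri k), integral_gaussD_affine hσ, integral_gaussD_affine hσ]
    simp only [eq, er, mul_left_comm _ t⁻¹]
    rw [integral_const_mul, integral_const_mul, integral_const_mul, gaussTail]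
  simp only [Pi.sub_def, hk, Finset.sum_sub_distrib, ← Finset.mul_sum, Finset.sum_const,
    Nat.card_Icc, add_tsub_cancel_right, nsmul_eq_mul] at hmono
  rw [scoreLoss]
  have h := mul_le_mul_of_nonneg_left hmono ht.le
  refine le_of_sub_nonneg ((sub_nonneg.2 h).trans (le_of_eq ?_))
  field_simp
  ring

end ScoreMatching

section Shat

variable {n : ℕ} {D t δ : ℝ} {s : ℝ → ℝ}

lemma trainPt_succ (n : ℕ) (D : ℝ) (k : ℕ) :
    trainPt n D (k + 1) = trainPt n D k + 2 * (D / ((n : ℝ) - 1)) := by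
  unfold trainPt; push_cast; ring

lemma IsShat.eq_near (hs : IsShat n D t δ s) {k : ℕ} (hk : k ∈ Finset.Icc 1 n) {x : ℝ}
    (hx : x ∈ Icc (trainPt n D k - δ) (trainPt n D k + δ)) : s x = (trainPt n D k - x) / t := by
  rw [Finset.mem_Icc] at hk
  rcases eq_or_ne k 1 with rfl | h1
  · exact hs.1 x hx.2
  rcases eq_or_ne k n with rfl | h2
  · exact hs.2.1 x hx.1
  exact hs.2.2.1 k (by omega) (by omega) x hx

lemma IsShat.sub_eq_right (hs : IsShat n D t δ s) (hδ : δ < D / ((n : ℝ) - 1)) {k : ℕ}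
    (hk : 1 ≤ k) (hkn : k ≤ n - 1) {x : ℝ}
    (hx : x ∈ Icc (trainPt n D k + δ) (trainPt n D k + D / ((n : ℝ) - 1))) :
    s x - (trainPt n D k - x) / t =
      (x - trainPt n D k - δ) * (D / ((n : ℝ) - 1) / (D / ((n : ℝ) - 1) - δ)) / t := by
  rw [hs.2.2.2 k hk hkn x ⟨hx.1, by rw [trainPt_succ]; linarith [hx.2]⟩]
  have := (sub_pos.2 hδ).ne'
  generalize D / ((n : ℝ) - 1) = d at *
  field_simp
  ring

lemma IsShat.sub_eq_left (hs : IsShat n D t δ s) (hδ : δ < D / ((n : ℝ) - 1)) {k : ℕ}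
    (hk : 1 ≤ k) (hkn : k ≤ n - 1) {x : ℝ}
    (hx : x ∈ Icc (trainPt n D (k + 1) - D / ((n : ℝ) - 1)) (trainPt n D (k + 1) - δ)) :
    s x - (trainPt n D (k + 1) - x) / t =
      -((trainPt n D (k + 1) - x - δ) * (D / ((n : ℝ) - 1) / (D / ((n : ℝ) - 1) - δ)) / t) := by
  rw [hs.2.2.2 k hk hkn x ⟨by have := hx.1; rw [trainPt_succ] at this; linarith, hx.2⟩,
    trainPt_succ]
  have := (sub_pos.2 hδ).ne'
  generalize D / ((n : ℝ) - 1) = d at *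
  field_simp
  ring

lemma IsShat.abs_le_of_mem_Icc (hs : IsShat n D t δ s) (ht : 0 < t) (hδ0 : 0 < δ)
    (hδ : δ < D / ((n : ℝ) - 1)) {m : ℕ} (hm : 1 ≤ m) (hmn : m ≤ n) {x : ℝ}
    (hx : x ∈ Icc (trainPt n D 1) (trainPt n D m)) : |s x| ≤ δ / t := by
  have near : ∀ k ∈ Finset.Icc 1 n, x ∈ Icc (trainPt n D k - δ) (trainPt n D k + δ) →
      |s x| ≤ δ / t := by
    intro k hk hx
    rw [hs.eq_near hk hx, abs_div, abs_of_pos ht]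
    gcongr
    rw [abs_le]
    constructor <;> linarith [hx.1, hx.2]
  induction m, hm using Nat.le_induction with
  | base => exact near 1 (by simp; omega) ⟨by linarith [hx.1], by linarith [hx.2]⟩
  | succ m hm ih =>
    rcases le_total x (trainPt n D m) with h | h
    · exact ih (by omega) ⟨hx.1, h⟩
    rcases le_total x (trainPt n D m + δ) with h1 | h1
    · exact near m (by simp; omega) ⟨by linarith, h1⟩
    rcases le_total (trainPt n D (m + 1) - δ) x with h2 | h2
    · exact near (m + 1) (by simp; omega) ⟨h2, by linarith [hx.2]⟩
    rw [hs.2.2.2 m hm (by omega) x ⟨h1, h2⟩, abs_div, abs_of_pos ht, abs_mul, abs_div,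
      abs_of_pos hδ0, abs_of_pos (sub_pos.2 hδ)]
    rw [trainPt_succ] at h2
    have h3 : |x - (trainPt n D m + D / ((n : ℝ) - 1))| ≤ D / ((n : ℝ) - 1) - δ := by
      rw [abs_le]; constructor <;> linarith
    gcongr
    have := sub_pos.2 hδ
    rw [div_mul_eq_mul_div, div_le_iff₀ this]
    gcongr

lemma IsShat.abs_le_of_far (hs : IsShat n D t δ s) (ht : 0 < t) (hδ0 : 0 < δ)
    (hδ : δ < D / ((n : ℝ) - 1)) {k : ℕ} (hk : k ∈ Finset.Icc 1 n) {x : ℝ}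
    (hx : D / ((n : ℝ) - 1) ≤ |x - trainPt n D k|) : |s x| ≤ |x - trainPt n D k| / t := by
  have hk' := Finset.mem_Icc.1 hk
  have m1 := trainPt_mono (n := n) (hδ0.trans hδ) hk'.1
  have m2 := trainPt_mono (n := n) (hδ0.trans hδ) hk'.2
  rcases le_total x (trainPt n D 1) with h | h
  · rw [hs.1 x (by linarith), abs_div, abs_of_pos ht]
    gcongr 1
    rw [abs_of_nonneg (by linarith), abs_of_nonpos (by linarith)]
    linarith
  rcases le_total (trainPt n D n) x with h2 | h2
  · rw [hs.2.1 x (by linarith), abs_div, abs_of_pos ht]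
    gcongr 1
    rw [abs_of_nonpos (by linarith), abs_of_nonneg (by linarith)]
    linarith
  refine (hs.abs_le_of_mem_Icc ht hδ0 hδ (by omega) le_rfl ⟨h, h2⟩).trans ?_
  gcongr
  linarith

/-- Pointwise majorant of the rescaled squared error of `ŝ` around a training point; `e` weighs
the left half-line. -/
noncomputable def shatMajorant (d κ t e u : ℝ) : ℝ :=
  (d / (d - κ * √t)) ^ 2 * (max (u - κ) 0 ^ 2 + e * max (-u - κ) 0 ^ 2) +
    {u : ℝ | d / √t ≤ |u|}.indicator (fun u => 4 * u ^ 2) u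

lemma integrable_shatMajorant (d κ t e : ℝ) :
    Integrable (fun u => gaussD u 1 * shatMajorant d κ t e u) ∧
      ∫ u, gaussD u 1 * shatMajorant d κ t e u =
        (d / (d - κ * √t)) ^ 2 * ((1 + e) * Fgauss κ / 2) + 4 * gaussTail (d / √t) := by
  have i1 := integrable_gaussD_mul_hinge κ
  have i2 : Integrable (fun u => gaussD u 1 * max (-u - κ) 0 ^ 2) := by
    simpa only [gaussD_neg] using i1.comp_neg
  have j2 : ∫ u, gaussD u 1 * max (-u - κ) 0 ^ 2 = Fgauss κ / 2 := by
    rw [← integral_gaussD_mul_hinge, ← integral_neg_eq_self]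
    simp only [gaussD_neg, neg_neg]
  have i3 := (integrable_gaussTail (d / √t)).const_mul 4
  have hsplit : ∀ u, gaussD u 1 * shatMajorant d κ t e u =
      (d / (d - κ * √t)) ^ 2 * (gaussD u 1 * max (u - κ) 0 ^ 2 +
        e * (gaussD u 1 * max (-u - κ) 0 ^ 2)) +
      4 * {u : ℝ | d / √t ≤ |u|}.indicator (fun u => u ^ 2 * gaussD u 1) u := by
    intro u
    simp only [shatMajorant, indicator_apply]
    split_ifs <;> ring
  have i4 := i1.add (i2.const_mul e)
  have i5 := i4.const_mul ((d / (d - κ * √t)) ^ 2)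
  simp only [Pi.add_apply] at i5
  simp only [hsplit]
  refine ⟨i5.add i3, ?_⟩
  rw [integral_add i5 i3, integral_const_mul, integral_const_mul,
    integral_add i1 (i2.const_mul e), integral_const_mul, j2,
    integral_gaussD_mul_hinge, gaussTail]
  ring

lemma IsShat.sq_le_shatMajorant {κ : ℝ} (hs : IsShat n D t (κ * √t) s) (ht : 0 < t) (hκ : 0 < κ)
    (hδ : κ * √t < D / ((n : ℝ) - 1)) {k : ℕ} (hk : k ∈ Finset.Icc 1 n) (u : ℝ) :
    (√t * s (trainPt n D k + √t * u) + u) ^ 2 ≤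
      shatMajorant (D / ((n : ℝ) - 1)) κ t (if k = 1 then 0 else 1) u := by
  have hσ := Real.sqrt_pos.2 ht
  have hk' := Finset.mem_Icc.1 hk
  have hδ0 : 0 < κ * √t := by positivity
  set d := D / ((n : ℝ) - 1) with hd
  set x := trainPt n D k + √t * u with hx
  have hxu : x - trainPt n D k = √t * u := by simp [hx]
  have htt : √t * √t = t := Real.mul_self_sqrt ht.le
  have key : √t * s x + u = √t * (s x - (trainPt n D k - x) / t) := by
    have : (trainPt n D k - x) / t = -(√t * u) / (√t * √t) := by rw [htt, ← hxu]; ring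
    rw [this]; field_simp; ring
  have hc : 0 ≤ (d / (d - κ * √t)) ^ 2 := sq_nonneg _
  set e : ℝ := if k = 1 then 0 else 1 with he
  have he0 : 0 ≤ e := by rw [he]; split_ifs <;> norm_num
  have hA : 0 ≤ (d / (d - κ * √t)) ^ 2 * (max (u - κ) 0 ^ 2 + e * max (-u - κ) 0 ^ 2) := by
    positivity
  have hB : 0 ≤ {u : ℝ | d / √t ≤ |u|}.indicator (fun u => 4 * u ^ 2) u :=
    indicator_nonneg (fun u _ => by positivity) u
  unfold shatMajorant
  by_cases hfar : d / √t ≤ |u|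
  · rw [indicator_of_mem (by exact hfar)]
    refine le_trans ?_ (le_add_of_nonneg_left hA)
    have h1 : d ≤ |x - trainPt n D k| := by
      rw [hxu, abs_mul, abs_of_pos hσ, mul_comm]
      exact (div_le_iff₀ hσ).1 hfar
    have h2 := hs.abs_le_of_far ht hδ0 hδ hk h1
    have h3 : |√t * s x| ≤ |u| := by
      rw [abs_mul, abs_of_pos hσ]
      rw [hxu, abs_mul, abs_of_pos hσ] at h2
      calc √t * |s x| ≤ √t * (√t * |u| / t) := by gcongr
        _ = |u| := by rw [← mul_div_assoc, ← mul_assoc, htt]; field_simp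
    have h4 := sq_le_sq.2 h3
    nlinarith [sq_nonneg (√t * s x - u)]
  · refine le_trans ?_ (le_add_of_nonneg_right hB)
    rw [not_le, lt_div_iff₀ hσ, mul_comm] at hfar
    have zero_of : s x = (trainPt n D k - x) / t → (√t * s x + u) ^ 2 ≤
        (d / (d - κ * √t)) ^ 2 * (max (u - κ) 0 ^ 2 + e * max (-u - κ) 0 ^ 2) := by
      intro h
      rw [key, h]
      simpa using hA
    rcases le_total |u| κ with hu | hu
    · refine zero_of (hs.eq_near hk ?_)
      have : |x - trainPt n D k| ≤ κ * √t := by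
        rw [hxu, abs_mul, abs_of_pos hσ, mul_comm]; gcongr
      rw [abs_le] at this
      constructor <;> linarith
    rcases le_total 0 u with hu0 | hu0
    · rw [abs_of_nonneg hu0] at hu hfar
      by_cases hkn : k = n
      · refine zero_of ?_
        subst hkn
        exact hs.2.1 x (by nlinarith)
      have h := hs.sub_eq_right hδ hk'.1 (by omega) (x := x)
        ⟨by nlinarith, by linarith⟩
      rw [key, h, hxu, max_eq_left (sub_nonneg.2 hu), max_eq_right (by linarith)]
      refine le_of_eq ?_
      have : √t * ((√t * u - κ * √t) * (d / (d - κ * √t)) / t) =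
          (u - κ) * (d / (d - κ * √t)) * (√t * √t / t) := by ring
      rw [this, htt, div_self ht.ne']
      ring
    · rw [abs_of_nonpos hu0] at hu hfar
      by_cases hk1 : k = 1
      · refine zero_of ?_
        rw [hk1] at hxu ⊢
        exact hs.1 x (by nlinarith)
      obtain ⟨j, rfl⟩ : ∃ j, k = j + 1 := ⟨k - 1, by omega⟩
      have h := hs.sub_eq_left hδ (k := j) (by omega) (by omega) (x := x)
        ⟨by linarith, by nlinarith⟩
      have hxu' : trainPt n D (j + 1) - x = √t * (-u) := by linarith
      have he1 : e = 1 := by rw [he, if_neg hk1]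
      rw [key, h, hxu', max_eq_left (a := -u - κ) (by linarith),
        max_eq_right (a := u - κ) (by linarith), he1]
      refine le_of_eq ?_
      have : √t * -((√t * -u - κ * √t) * (d / (d - κ * √t)) / t) =
          -((-u - κ) * (d / (d - κ * √t)) * (√t * √t / t)) := by ring
      rw [this, htt, div_self ht.ne']
      ring

lemma IsShat.scoreLoss_le {κ : ℝ} (hs : IsShat n D t (κ * √t) s) (hn : 2 ≤ n) (ht : 0 < t)
    (hκ : 0 < κ) (hδ : κ * √t < D / ((n : ℝ) - 1)) :
    scoreLoss n D t s ≤
      (1 - 1 / (2 * (n : ℝ))) *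
          ((D / ((n : ℝ) - 1) / (D / ((n : ℝ) - 1) - κ * √t)) ^ 2 * Fgauss κ) +
        4 * gaussTail (D / ((n : ℝ) - 1) / √t) := by
  have hn0 : (0 : ℝ) < n := by positivity
  refine (_root_.scoreLoss_le (by omega) ht (fun k _ => (integrable_shatMajorant _ κ t _).1)
    (fun k hk u => hs.sq_le_shatMajorant ht hκ hδ hk u)).trans (le_of_eq ?_)
  simp only [(integrable_shatMajorant _ κ t _).2]
  rw [← Finset.add_sum_Ioc_eq_sum_Icc (show 1 ≤ n by omega)]
  rw [Finset.sum_congr rfl (g := fun _ => (D / ((n : ℝ) - 1) / (D / ((n : ℝ) - 1) - κ * √t)) ^ 2 *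
    Fgauss κ + 4 * gaussTail (D / ((n : ℝ) - 1) / √t)) (fun k hk => by
      rw [if_neg (by simp at hk; omega)]; ring)]
  rw [if_pos rfl, Finset.sum_const, Nat.card_Ioc, nsmul_eq_mul, Nat.cast_sub (by omega)]
  generalize (D / ((n : ℝ) - 1) / (D / ((n : ℝ) - 1) - κ * √t)) ^ 2 = c
  push_cast
  field_simp
  ring

lemma IsShat.rns_eq (hs : IsShat n D t δ s) (hn : 2 ≤ n) (ht : 0 < t) (hδ0 : 0 < δ)
    (hδ : δ < D / ((n : ℝ) - 1)) :
    Rns s = ENNReal.ofReal (2 * ((n : ℝ) - 1) * (D / ((n : ℝ) - 1)) /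
      (t * (D / ((n : ℝ) - 1) - δ))) := by
  have hnr : ((n - 1 : ℕ) : ℝ) = (n : ℝ) - 1 := by rw [Nat.cast_sub (by omega)]; simp
  set d := D / ((n : ℝ) - 1) with hd
  have hdδ : 0 < d - δ := sub_pos.2 hδ
  set y := trainPt n D with hy
  set S := {x | DifferentiableAt ℝ s x} with hS
  set β := δ / (d - δ) / t with hβ
  set α := -(1 / t) with hα
  have hjump : β - α = d / (t * (d - δ)) := by rw [hβ, hα]; field_simp; ring
  have hjump0 : 0 < β - α := by rw [hjump]; have := hδ0.trans hδ; positivity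
  have near : ∀ k ∈ Finset.Icc 1 n, ∀ x ∈ Icc (y k - δ) (y k + δ), s x = α * x + y k / t := by
    intro k hk x hx
    rw [hs.eq_near hk hx, hα]; ring
  have bridge : ∀ k, 1 ≤ k → k ≤ n - 1 → ∀ x ∈ Icc (y k + δ) (y (k + 1) - δ),
      s x = β * x + -(β * (y k + d)) := by
    intro k h1 h2 x hx
    rw [hs.2.2.2 k h1 h2 x hx, hβ]; ring
  have ySucc : ∀ k, y (k + 1) = y k + 2 * d := trainPt_succ n D
  have hyS : ∀ k ∈ Finset.Icc 1 n, y k ∈ S ∧ deriv s (y k) = α := by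
    intro k hk
    have h := differentiableAt_of_eqOn_Icc (near k hk) (x := y k)
      ⟨by linarith, by linarith⟩
    exact ⟨h, deriv_eq_of_eqOn_Icc (near k hk) ⟨by linarith, by linarith⟩ h⟩
  have hzS : ∀ k, 1 ≤ k → k ≤ n - 1 → y k + d ∈ S ∧ deriv s (y k + d) = β := by
    intro k h1 h2
    have h := differentiableAt_of_eqOn_Icc (bridge k h1 h2) (x := y k + d)
      ⟨by linarith, by rw [ySucc]; linarith⟩
    exact ⟨h, deriv_eq_of_eqOn_Icc (bridge k h1 h2) ⟨by linarith, by rw [ySucc]; linarith⟩ h⟩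
  have outerL : eVariationOn (deriv s) (S ∩ Iic (y 1)) = 0 := by
    refine eVariationOn.constant_on ?_
    refine subsingleton_of_forall_eq α ?_
    rintro _ ⟨x, ⟨hxS, hx⟩, rfl⟩
    refine deriv_eq_of_eqOn_Icc (l := x) (r := y 1 + δ) (q := y 1 / t) (fun z hz => ?_)
      ⟨le_rfl, by linarith [mem_Iic.1 hx]⟩ hxS
    rw [hs.1 z hz.2, hα]; ring
  have outerR : eVariationOn (deriv s) (S ∩ Ici (y n)) = 0 := by
    refine eVariationOn.constant_on ?_
    refine subsingleton_of_forall_eq α ?_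
    rintro _ ⟨x, ⟨hxS, hx⟩, rfl⟩
    refine deriv_eq_of_eqOn_Icc (l := x) (r := x + 1) (q := y n / t) (fun z hz => ?_)
      ⟨le_rfl, by linarith⟩ hxS
    rw [hs.2.1 z (by linarith [mem_Ici.1 hx, hz.1]), hα]; ring
  have upper : ∀ m, m + 1 ≤ n → eVariationOn (deriv s) (S ∩ Iic (y (m + 1))) ≤
      ENNReal.ofReal (2 * m * (β - α)) := by
    intro m
    induction m with
    | zero => intro _; simp [outerL]
    | succ m ih =>
      intro hm
      have y1 := hyS (m + 1) (by simp; omega)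
      have y2 := hyS (m + 1 + 1) (by simp; omega)
      have z1 := hzS (m + 1) (by omega) (by omega)
      have hyy := ySucc (m + 1)
      have u1 : S ∩ Iic (y (m + 1 + 1)) = (S ∩ Iic (y (m + 1))) ∪
          ((S ∩ Icc (y (m + 1)) (y (m + 1) + d)) ∪
            (S ∩ Icc (y (m + 1) + d) (y (m + 1 + 1)))) := by
        rw [← inter_union_distrib_left, ← inter_union_distrib_left,
          Icc_union_Icc_eq_Icc (by linarith) (by linarith), Iic_union_Icc_eq_Iic (by linarith)]
      rw [u1, eVariationOn.union (deriv s) (s := S ∩ Iic (y (m + 1))) (x := y (m + 1))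
          ⟨⟨y1.1, mem_Iic.2 le_rfl⟩, fun z hz => hz.2⟩ ⟨Or.inl ⟨y1.1, le_rfl, by linarith⟩, ?_⟩,
        eVariationOn.union (deriv s) (s := S ∩ Icc (y (m + 1)) (y (m + 1) + d))
          (t := S ∩ Icc (y (m + 1) + d) (y (m + 1 + 1))) (x := y (m + 1) + d)
          ⟨⟨z1.1, by linarith, le_rfl⟩, fun z hz => hz.2.2⟩
          ⟨⟨z1.1, le_rfl, by linarith⟩, fun z hz => hz.2.1⟩]
      · have b1 : eVariationOn (deriv s) (S ∩ Icc (y (m + 1)) (y (m + 1) + d)) ≤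
            ENNReal.ofReal |β - α| := by
          refine eVariationOn_le_of_step (p := y (m + 1) + δ) ?_ ?_
          · rintro x ⟨hxS, hx⟩ hlt
            exact deriv_eq_of_eqOn_Icc (near (m + 1) (by simp; omega))
              ⟨by linarith [hx.1], hlt⟩ hxS
          · rintro x ⟨hxS, hx⟩ hle
            exact deriv_eq_of_eqOn_Icc (bridge (m + 1) (by omega) (by omega))
              ⟨hle, by linarith [hx.2]⟩ hxS
        have b2 : eVariationOn (deriv s) (S ∩ Icc (y (m + 1) + d) (y (m + 1 + 1))) ≤
            ENNReal.ofReal |α - β| := by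
          refine eVariationOn_le_of_step (p := y (m + 1 + 1) - δ) ?_ ?_
          · rintro x ⟨hxS, hx⟩ hlt
            exact deriv_eq_of_eqOn_Icc (bridge (m + 1) (by omega) (by omega))
              ⟨by linarith [hx.1], hlt⟩ hxS
          · rintro x ⟨hxS, hx⟩ hle
            exact deriv_eq_of_eqOn_Icc (near (m + 1 + 1) (by simp; omega))
              ⟨hle, by linarith [hx.2]⟩ hxS
        rw [abs_of_pos hjump0] at b1
        rw [abs_sub_comm, abs_of_pos hjump0] at b2
        refine (add_le_add (ih (by omega)) (add_le_add b1 b2)).trans (le_of_eq ?_)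
        rw [← ENNReal.ofReal_add hjump0.le hjump0.le,
          ← ENNReal.ofReal_add (by positivity) (by positivity)]
        congr 1
        push_cast
        ring
      · rintro z (⟨_, hz⟩ | ⟨_, hz⟩)
        · exact hz.1
        · linarith [hz.1]
  have lower := sum_zigzag_le_eVariationOn (g := deriv s) (S := S) (a := fun i => y (i + 1))
    (b := fun i => y (i + 1) + d) (N := n - 1)
    (fun i hi => (hyS (i + 1) (by simp; omega)).1) (fun i hi => (hzS (i + 1) (by omega) (by omega)).1)
    (fun i _ => by linarith) (fun i _ => by simp only [ySucc (i + 1)]; linarith) (n - 1) le_rfl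
  have hsum : ∑ i ∈ Finset.range (n - 1), ((deriv s (y (i + 1) + d) - deriv s (y (i + 1))) +
      (deriv s (y (i + 1) + d) - deriv s (y (i + 1 + 1)))) = 2 * ((n - 1 : ℕ) : ℝ) * (β - α) := by
    rw [Finset.sum_congr rfl (g := fun _ => 2 * (β - α))]
    · rw [Finset.sum_const, Finset.card_range, nsmul_eq_mul]; ring
    · intro i hi
      rw [Finset.mem_range] at hi
      rw [(hyS (i + 1) (by simp; omega)).2, (hyS (i + 1 + 1) (by simp; omega)).2,
        (hzS (i + 1) (by omega) (by omega)).2]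
      ring
  rw [hsum] at lower
  have hval : 2 * ((n : ℝ) - 1) * d / (t * (d - δ)) = 2 * ((n - 1 : ℕ) : ℝ) * (β - α) := by
    rw [hjump, hnr]; ring
  rw [hval]
  apply le_antisymm
  · have h1 : n - 1 + 1 = n := by omega
    have h2 := upper (n - 1) (by omega)
    rw [h1] at h2
    have yn := hyS n (by simp; omega)
    have u1 : S = (S ∩ Iic (y n)) ∪ (S ∩ Ici (y n)) := by
      rw [← inter_union_distrib_left, Iic_union_Ici, inter_univ]
    change eVariationOn (deriv s) S ≤ _
    rw [u1, eVariationOn.union (deriv s) (s := S ∩ Iic (y n)) (t := S ∩ Ici (y n)) (x := y n)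
      ⟨⟨yn.1, mem_Iic.2 le_rfl⟩, fun z hz => hz.2⟩
      ⟨⟨yn.1, mem_Ici.2 le_rfl⟩, fun z hz => hz.2⟩, outerR, add_zero]
    exact h2
  · exact lower.trans (eVariationOn.mono _ inter_subset_left)

end Shat

section LowerBound

lemma exists_deriv_lt_of_integral_lt {f : ℝ → ℝ} (hf : Continuous f)
    (hfin : {x | ¬ DifferentiableAt ℝ f x}.Finite) {K : ℝ} (hK : ∀ x, |deriv f x| ≤ K)
    {t y A ρ : ℝ} (ht : 0 < t) (hρ : 0 < ρ)
    (hi : Integrable (fun u => gaussD u 1 * (√t * f (y + √t * u) + u) ^ 2))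
    (hlt : ∫ u, gaussD u 1 * (√t * f (y + √t * u) + u) ^ 2 < ρ ^ 2 * (1 - gaussTail A)) :
    ∃ c ∈ Ioo (y - A * √t) (y + A * √t), DifferentiableAt ℝ f c ∧
      deriv f c < -(1 - ρ) / t := by
  have hσ := Real.sqrt_pos.2 ht
  have htt : √t * √t = t := Real.mul_self_sqrt ht.le
  by_contra! H
  refine hlt.not_ge ?_
  set h : ℝ → ℝ := fun u => √t * f (y + √t * u) + u with hh
  have slope : ∀ u, 0 ≤ u → u < A → 2 * ρ * u ≤ h u - h (-u) := by
    intro u hu0 huA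
    have hA : √t * u ≤ A * √t := by rw [mul_comm]; gcongr
    have h1 := mul_sub_le_of_le_deriv hf hfin hK (a := y + √t * -u) (b := y + √t * u)
      (m := -(1 - ρ) / t) (by nlinarith)
      (fun c hc hd => H c ⟨by linarith [hc.1], by linarith [hc.2]⟩ hd)
    have h2 := mul_le_mul_of_nonneg_left h1 hσ.le
    have h3 : √t * (-(1 - ρ) / t * (y + √t * u - (y + √t * -u))) =
        -(1 - ρ) * (2 * u) * (√t * √t / t) := by ring
    rw [h3, htt, div_self ht.ne'] at h2
    simp only [hh]
    linarith
  have hsq : ∀ u, 0 ≤ u → u < A → 2 * ρ ^ 2 * u ^ 2 ≤ h u ^ 2 + h (-u) ^ 2 := by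
    intro u hu0 huA
    have h1 := slope u hu0 huA
    have h2 : (2 * ρ * u) ^ 2 ≤ (h u - h (-u)) ^ 2 := by gcongr
    nlinarith [sq_nonneg (h u + h (-u))]
  have hsq' : ∀ u, |u| < A → 2 * ρ ^ 2 * u ^ 2 ≤ h u ^ 2 + h (-u) ^ 2 := by
    intro u hu
    rcases le_total 0 u with h0 | h0
    · exact hsq u h0 ((le_abs_self u).trans_lt hu)
    · have := hsq (-u) (by linarith) ((neg_le_abs u).trans_lt hu)
      rw [neg_neg, neg_sq] at this
      linarith
  have hi' : Integrable (fun u => gaussD u 1 * h (-u) ^ 2) := by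
    simpa only [gaussD_neg] using hi.comp_neg
  have he' : ∫ u, gaussD u 1 * h (-u) ^ 2 = ∫ u, gaussD u 1 * h u ^ 2 := by
    rw [← integral_neg_eq_self]
    simp only [gaussD_neg, neg_neg]
  have hmono := integral_mono
    ((integrable_sq_mul_gaussD.sub (integrable_gaussTail A)).const_mul (2 * ρ ^ 2)) (hi.add hi')
    (fun u => by
      have hp := gaussD_pos one_pos u
      simp only [Pi.sub_apply, Pi.add_apply, indicator_apply, mem_ofPred_eq]
      split_ifs with hc
      · simp only [sub_self, mul_zero]
        positivity
      · have := mul_le_mul_of_nonneg_left (hsq' u (not_le.1 hc)) hp.le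
        simp only [hh] at this ⊢
        linarith)
  rw [integral_const_mul] at hmono
  simp only [Pi.sub_apply, Pi.add_apply] at hmono
  rw [integral_sub integrable_sq_mul_gaussD (integrable_gaussTail A), integral_sq_mul_gaussD,
    integral_add hi hi', he', ← gaussTail] at hmono
  linarith

lemma gaussD_one_le_of_abs_le {u M : ℝ} (h : |u| ≤ M) : gaussD M 1 ≤ gaussD u 1 := by
  have := sq_le_sq' (abs_le.1 h).1 (abs_le.1 h).2
  unfold gaussD
  gcongr

lemma exists_mem_Icc_gaussD_mul_sq_le {h : ℝ → ℝ}
    (hi : Integrable (fun u => gaussD u 1 * h u ^ 2)) {p M B : ℝ}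
    (hM : ∀ u ∈ Icc p (p + 1), |u| ≤ M) (hB : ∫ u, gaussD u 1 * h u ^ 2 < B) :
    ∃ u ∈ Icc p (p + 1), gaussD M 1 * h u ^ 2 ≤ B := by
  by_contra! H
  refine hB.not_ge ?_
  have h1 : ∫ u in Icc p (p + 1), gaussD u 1 * h u ^ 2 ≤ ∫ u, gaussD u 1 * h u ^ 2 :=
    setIntegral_le_integral hi (Eventually.of_forall fun u =>
      mul_nonneg (gaussD_pos one_pos u).le (sq_nonneg _))
  refine le_trans ?_ h1
  have h2 : ∫ _ in Icc p (p + 1), B = B := by simp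
  rw [← h2]
  refine setIntegral_mono_on (by simp) hi.integrableOn measurableSet_Icc fun u hu => ?_
  exact (H u hu).le.trans
    (mul_le_mul_of_nonneg_right (gaussD_one_le_of_abs_le (hM u hu)) (sq_nonneg _))

lemma abs_le_of_deriv_bounded {f : ℝ → ℝ} (hf : Continuous f)
    (hfin : {x | ¬ DifferentiableAt ℝ f x}.Finite) {K : ℝ} (hK : ∀ x, |deriv f x| ≤ K) (x : ℝ) :
    |f x| ≤ |f 0| + K * |x| := by
  obtain ⟨_, he⟩ := integral_deriv_eq_sub_of_bounded hf hfin hK 0 x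
  have h := intervalIntegral.norm_integral_le_of_norm_le_const (a := 0) (b := x) (f := deriv f)
    (C := K) (fun z _ => hK z)
  rw [he, sub_zero, Real.norm_eq_abs] at h
  have := abs_sub_abs_le_abs_sub (f x) (f 0)
  linarith

lemma integrable_rescaled_sq {f : ℝ → ℝ} (hf : Continuous f)
    (hfin : {x | ¬ DifferentiableAt ℝ f x}.Finite) {K : ℝ} (hK : ∀ x, |deriv f x| ≤ K)
    (t y : ℝ) : Integrable (fun u => gaussD u 1 * (√t * f (y + √t * u) + u) ^ 2) := by
  have hK0 : 0 ≤ K := (abs_nonneg _).trans (hK 0)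
  have hσ := Real.sqrt_nonneg t
  refine integrable_gaussD_mul_sq_of_linear_growth (h := fun u => √t * f (y + √t * u) + u)
    (by fun_prop) (a := √t * (|f 0| + K * |y|)) (b := √t * K * √t + 1) fun u => ?_
  have h1 := abs_le_of_deriv_bounded hf hfin hK (y + √t * u)
  have h2 : |y + √t * u| ≤ |y| + √t * |u| := by
    refine (abs_add_le _ _).trans ?_
    rw [abs_mul, abs_of_nonneg hσ]
  calc |√t * f (y + √t * u) + u| ≤ √t * |f (y + √t * u)| + |u| := by
        refine (abs_add_le _ _).trans ?_
        rw [abs_mul, abs_of_nonneg hσ]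
    _ ≤ √t * (|f 0| + K * (|y| + √t * |u|)) + |u| := by gcongr; exact h1.trans (by gcongr)
    _ = _ := by ring

lemma exists_deriv_gt_between {f : ℝ → ℝ} (hf : Continuous f)
    (hfin : {x | ¬ DifferentiableAt ℝ f x}.Finite) {K : ℝ} (hK : ∀ x, |deriv f x| ≤ K)
    {t y y' d A B ω : ℝ} (ht : 0 < t) (hd : 0 < d) (hA : 0 ≤ A) (hyy : y' = y + 2 * d)
    (hAd : (A + 1) * √t ≤ d / 2)
    (hω : 2 * (√(B / gaussD (A + 1) 1) + (A + 1)) * √t < ω * d)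
    (hB : ∫ u, gaussD u 1 * (√t * f (y + √t * u) + u) ^ 2 < B)
    (hB' : ∫ u, gaussD u 1 * (√t * f (y' + √t * u) + u) ^ 2 < B) :
    ∃ c ∈ Ioo (y + A * √t) (y' - A * √t), DifferentiableAt ℝ f c ∧ -ω / t < deriv f c := by
  have hσ := Real.sqrt_pos.2 ht
  have htt : √t * √t = t := Real.mul_self_sqrt ht.le
  have hg := gaussD_pos one_pos (A + 1)
  set C := √(B / gaussD (A + 1) 1) + (A + 1) with hC
  have bound : ∀ z u, |u| ≤ A + 1 →
      gaussD (A + 1) 1 * (√t * f (z + √t * u) + u) ^ 2 ≤ B → |√t * f (z + √t * u)| ≤ C := by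
    intro z u hu h
    have h1 : |√t * f (z + √t * u) + u| ≤ √(B / gaussD (A + 1) 1) :=
      Real.abs_le_sqrt (by rwa [le_div_iff₀' hg])
    have h2 := abs_sub (√t * f (z + √t * u) + u) u
    rw [add_sub_cancel_right] at h2
    linarith
  have hM1 : ∀ u ∈ Icc A (A + 1), |u| ≤ A + 1 := fun u hu =>
    abs_le.2 ⟨by linarith [hu.1], hu.2⟩
  have hM2 : ∀ u ∈ Icc (-(A + 1)) (-(A + 1) + 1), |u| ≤ A + 1 := fun u hu =>
    abs_le.2 ⟨hu.1, by linarith [hu.2]⟩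
  obtain ⟨u, hu, hu2⟩ := exists_mem_Icc_gaussD_mul_sq_le
    (h := fun u => √t * f (y + √t * u) + u) (integrable_rescaled_sq hf hfin hK t y) hM1 hB
  obtain ⟨v, hv, hv2⟩ := exists_mem_Icc_gaussD_mul_sq_le
    (h := fun u => √t * f (y' + √t * u) + u) (integrable_rescaled_sq hf hfin hK t y') hM2 hB'
  have bu := bound y u (hM1 u hu) hu2
  have bv := bound y' v (hM2 v hv) hv2
  have l1 : A * √t ≤ √t * u := by rw [mul_comm]; gcongr; exact hu.1
  have l2 : √t * u ≤ d / 2 := by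
    refine le_trans ?_ hAd; rw [mul_comm]; gcongr; exact hu.2
  have l3 : √t * v ≤ -(A * √t) := by
    rw [show -(A * √t) = √t * -A by ring]; gcongr; linarith [hv.2]
  have l4 : -(d / 2) ≤ √t * v := by
    refine (neg_le_neg hAd).trans ?_
    rw [show -((A + 1) * √t) = √t * -(A + 1) by ring]; gcongr; exact hv.1
  by_contra! H
  have h1 := sub_le_mul_of_deriv_le hf hfin hK (a := y + √t * u) (b := y' + √t * v)
    (m := -ω / t) (by linarith)
    (fun c hc hd => H c ⟨by linarith [hc.1], by linarith [hc.2]⟩ hd)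
  have h2 := mul_le_mul_of_nonneg_left h1 hσ.le
  have h3 := (abs_le.1 bu).2
  have h4 := (abs_le.1 bv).1
  have hω0 : 0 < ω := by
    have hC0 : 0 ≤ C := by positivity
    by_contra! h
    nlinarith [mul_nonneg hC0 hσ.le]
  set L := y' + √t * v - (y + √t * u) with hL
  have hLd : d ≤ L := by rw [hL]; linarith
  have h5 : -2 * C ≤ √t * (-ω / t * L) := by rw [mul_sub] at h2; linarith
  have h6 := mul_le_mul_of_nonneg_left h5 hσ.le
  have h7 : √t * (√t * (-ω / t * L)) = -ω * L := by
    rw [← mul_assoc, htt]; field_simp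
  rw [h7] at h6
  linarith [mul_le_mul_of_nonneg_left hLd hω0.le]

variable {n : ℕ} {D t ε A : ℝ}

lemma le_rns_of_scoreLoss_lt (hn : 2 ≤ n) (hΔ : 0 < D / ((n : ℝ) - 1)) (ht : 0 < t) (hε : 0 < ε)
    (hA : 0 ≤ A) (hAt : gaussTail A ≤ 1 / 4)
    (htail : 4 * gaussTail (D / ((n : ℝ) - 1) / √t) ≤ ε / 2)
    (hAd : (A + 1) * √t ≤ D / ((n : ℝ) - 1) / 2)
    (hω : 2 * (√(2 * n * ε / gaussD (A + 1) 1) + (A + 1)) * √t <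
      √ε / 100 * (D / ((n : ℝ) - 1)))
    {f : ℝ → ℝ} (hf : Continuous f) (hfin : {x | ¬ DifferentiableAt ℝ f x}.Finite)
    (hR : Rns f ≠ ⊤) (hL : scoreLoss n D t f < ε) :
    ENNReal.ofReal (2 * ((n : ℝ) - 1) * (1 - √ε / 100 - 3.5 * √ε) / t) ≤ Rns f := by
  obtain ⟨K, hK⟩ := deriv_bounded_of_variation hfin hR
  have hn0 : (0 : ℝ) < n := by positivity
  set d := D / ((n : ℝ) - 1) with hd
  set q := √ε with hq
  have hq0 : 0 < q := Real.sqrt_pos.2 hε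
  have hqq : q ^ 2 = ε := Real.sq_sqrt hε.le
  set y : ℕ → ℝ := fun i => trainPt n D (i + 1) with hy
  set E : ℕ → ℝ := fun i => ∫ u, gaussD u 1 * (√t * f (y i + √t * u) + u) ^ 2 with hE
  have hE0 : ∀ i, 0 ≤ E i := fun i => integral_nonneg fun u =>
    mul_nonneg (gaussD_pos one_pos u).le (sq_nonneg _)
  have hsumE : ∑ i ∈ Finset.range n, E i < 1.5 * n * ε := by
    have h := sum_integral_le_scoreLoss (n := n) (D := D) (by omega) hΔ ht hf
      (fun k => integrable_rescaled_sq hf hfin hK t _)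
    have h1 : ∑ i ∈ Finset.range n, E i = ∑ k ∈ Finset.Icc 1 n,
        ∫ u, gaussD u 1 * (√t * f (trainPt n D k + √t * u) + u) ^ 2 := by
      rw [Finset.range_eq_Ico, Finset.sum_Ico_add'
        (fun k => ∫ u, gaussD u 1 * (√t * f (trainPt n D k + √t * u) + u) ^ 2) 0 n 1]
      rfl
    rw [← h1, one_div, inv_mul_le_iff₀ hn0] at h
    have h2 : (n : ℝ) * (scoreLoss n D t f + 4 * gaussTail (d / √t)) < n * (1.5 * ε) := by
      gcongr
      linarith
    linarith
  have hEB : ∀ i < n, E i < 2 * n * ε := by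
    intro i hi
    have := Finset.single_le_sum (fun j _ => hE0 j) (Finset.mem_range.2 hi)
    have : 0 < n * ε := by positivity
    linarith
  set ρ : ℕ → ℝ := fun i => E i / (1.75 * q) + 1.75 * q / 2 with hρ
  have hρ0 : ∀ i, 0 < ρ i := fun i => by
    have := hE0 i
    simp only [hρ]; positivity
  have hρE : ∀ i, E i < ρ i ^ 2 * (1 - gaussTail A) := by
    intro i
    have h1 : 2 * E i ≤ ρ i ^ 2 := by
      have : ρ i ^ 2 = (E i / (1.75 * q) - 1.75 * q / 2) ^ 2 + 2 * E i := by
        simp only [hρ]; field_simp; ring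
      rw [this]
      linarith [sq_nonneg (E i / (1.75 * q) - 1.75 * q / 2)]
    have h2 : ρ i ^ 2 * (3 / 4) ≤ ρ i ^ 2 * (1 - gaussTail A) := by
      gcongr; linarith
    have h3 := hE0 i
    have h4 := pow_pos (hρ0 i) 2
    linarith
  have hlow : ∀ i, ∃ c ∈ Ioo (y i - A * √t) (y i + A * √t), DifferentiableAt ℝ f c ∧
      deriv f c < -(1 - ρ i) / t := fun i =>
    exists_deriv_lt_of_integral_lt hf hfin hK ht (hρ0 i)
      (integrable_rescaled_sq hf hfin hK t _) (hρE i)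
  have hhigh : ∀ i, ∃ c, i < n - 1 → c ∈ Ioo (y i + A * √t) (y (i + 1) - A * √t) ∧
      DifferentiableAt ℝ f c ∧ -(q / 100) / t < deriv f c := by
    intro i
    by_cases hi : i < n - 1
    · obtain ⟨c, hc⟩ := exists_deriv_gt_between hf hfin hK ht hΔ hA
        (trainPt_succ n D (i + 1)) hAd hω (hEB i (by omega)) (hEB (i + 1) (by omega))
      exact ⟨c, fun _ => hc⟩
    · exact ⟨0, fun h => absurd h hi⟩
  choose a ha using hlow
  choose b hb using hhigh
  have hvar := sum_zigzag_le_eVariationOn (g := deriv f) (S := {x | DifferentiableAt ℝ f x})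
    (a := a) (b := b) (N := n - 1) (fun i _ => (ha i).2.1) (fun i hi => (hb i hi).2.1)
    (fun i hi => ((ha i).1.2.trans (hb i hi).1.1).le)
    (fun i hi => ((hb i hi).1.2.trans (ha (i + 1)).1.1).le) (n - 1) le_rfl
  refine le_trans ?_ (hvar.trans (eVariationOn.mono _ inter_subset_left))
  refine ENNReal.ofReal_le_ofReal ?_
  have hterm : ∀ i ∈ Finset.range (n - 1),
      (2 * (1 - q / 100) - ρ i - ρ (i + 1)) / t ≤
      (deriv f (b i) - deriv f (a i)) + (deriv f (b i) - deriv f (a (i + 1))) := by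
    intro i hi
    have h1 := (ha i).2.2
    have h2 := (ha (i + 1)).2.2
    have h3 := (hb i (Finset.mem_range.1 hi)).2.2
    have : (2 * (1 - q / 100) - ρ i - ρ (i + 1)) / t =
      2 * (-(q / 100) / t) - -(1 - ρ i) / t - -(1 - ρ (i + 1)) / t := by ring
    rw [this]
    linarith
  refine le_trans ?_ (Finset.sum_le_sum hterm)
  rw [← Finset.sum_div]
  gcongr
  rw [Finset.sum_sub_distrib, Finset.sum_sub_distrib, Finset.sum_const, Finset.card_range,
    nsmul_eq_mul]
  obtain ⟨N, rfl⟩ : ∃ N, n = N + 1 := ⟨n - 1, by omega⟩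
  have hN : (1 : ℝ) ≤ N := by exact_mod_cast (show 1 ≤ N by omega)
  have s1 := Finset.sum_range_succ ρ N
  have s2 := Finset.sum_range_succ' ρ N
  have p1 := hρ0 N
  have p2 := hρ0 0
  have hsumρ : ∑ i ∈ Finset.range (N + 1), ρ i ≤ (N + 1) * (1.75 * q) := by
    simp only [hρ]
    rw [Finset.sum_add_distrib, ← Finset.sum_div, Finset.sum_const, Finset.card_range,
      nsmul_eq_mul]
    have : (∑ i ∈ Finset.range (N + 1), E i) / (1.75 * q) ≤ (N + 1) * (0.875 * q) := by
      rw [div_le_iff₀ (by positivity)]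
      refine hsumE.le.trans ?_
      rw [← hqq]
      push_cast
      nlinarith [mul_nonneg (show (0 : ℝ) ≤ N + 1 by positivity) (sq_nonneg q)]
    push_cast
    linarith
  simp only [Nat.add_sub_cancel]
  push_cast
  nlinarith [mul_nonneg (sub_nonneg.2 hN) hq0.le]

end LowerBound

/-- near-optimality of the smoothed PL-ESF for the variational problem. -/
theorem stmt_2 (n : ℕ) (hn : 2 ≤ n) (D : ℝ) (hD : 0 < D)
    (ε : ℝ) (hε : ε ∈ Set.Ioo (0 : ℝ) 0.015)
    (κ : ℝ) (hκ : 0 < κ) (hFκ : Fgauss κ ≤ ε) :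
    ∃ t₁ > (0 : ℝ), ∀ t ∈ Set.Ioo 0 t₁,
      (κ * Real.sqrt t ∈ Set.Ioo 0 (D / ((n : ℝ) - 1)) ∧
        ∀ s : ℝ → ℝ, IsShat n D t (κ * Real.sqrt t) s →
          scoreLoss n D t s < ε ∧
          Rns s = ENNReal.ofReal (2 * ((n : ℝ) - 1) * (D / ((n : ℝ) - 1)) /
            (t * (D / ((n : ℝ) - 1) - κ * Real.sqrt t)))) ∧
      ∀ f : ℝ → ℝ, Continuous f → {x | ¬ DifferentiableAt ℝ f x}.Finite →
        scoreLoss n D t f < ε →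
        ENNReal.ofReal (2 * ((n : ℝ) - 1) * (D / ((n : ℝ) - 1)) /
            (t * (D / ((n : ℝ) - 1) - κ * Real.sqrt t))) <
          ENNReal.ofReal (1 + 8 * Real.sqrt ε) * Rns f := by
  have hn' : (2 : ℝ) ≤ n := by exact_mod_cast hn
  have hd : 0 < D / ((n : ℝ) - 1) := div_pos hD (by linarith)
  have hq : 0 < √ε := Real.sqrt_pos.2 hε.1
  have hqq : √ε * √ε = ε := Real.mul_self_sqrt hε.1.le
  have hq' : √ε < 0.1225 := by nlinarith [hε.2]
  obtain ⟨A, hAt, hA⟩ := ((tendsto_gaussTail.eventually_le_const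
    (show (0 : ℝ) < 1 / 4 by norm_num)).and (eventually_ge_atTop 0)).exists
  set d := D / ((n : ℝ) - 1) with hd_def
  have hsqrt : Tendsto (fun t : ℝ => √t) (nhdsWithin 0 (Ioi 0)) (nhdsWithin 0 (Ioi 0)) := by
    refine tendsto_nhdsWithin_iff.2 ⟨?_, ?_⟩
    · simpa using (Real.continuous_sqrt.tendsto 0).mono_left nhdsWithin_le_nhds
    · filter_upwards [self_mem_nhdsWithin] with t ht using Real.sqrt_pos.2 ht
  have hsqrt0 : Tendsto (fun t : ℝ => √t) (nhdsWithin 0 (Ioi 0)) (nhds 0) :=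
    hsqrt.mono_right nhdsWithin_le_nhds
  have hlin (c : ℝ) : Tendsto (fun t : ℝ => c * √t) (nhdsWithin 0 (Ioi 0)) (nhds 0) := by
    simpa using hsqrt0.const_mul c
  have hratio : Tendsto (fun t : ℝ => d / (d - κ * √t)) (nhdsWithin 0 (Ioi 0)) (nhds 1) := by
    have h := (tendsto_const_nhds (x := d)).div ((tendsto_const_nhds (x := d)).sub (hlin κ))
      (by simpa using hd.ne')
    rwa [sub_zero, div_self hd.ne'] at h
  have htail : Tendsto (fun t : ℝ => 4 * gaussTail (d / √t)) (nhdsWithin 0 (Ioi 0)) (nhds 0) := by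
    have h : Tendsto (fun t : ℝ => d / √t) (nhdsWithin 0 (Ioi 0)) atTop := by
      simpa only [div_eq_mul_inv, Function.comp_def] using (tendsto_inv_nhdsGT_zero.comp hsqrt).const_mul_atTop hd
    simpa using (tendsto_gaussTail.comp h).const_mul 4
  have hloss : Tendsto (fun t : ℝ => (1 - 1 / (2 * (n : ℝ))) * ((d / (d - κ * √t)) ^ 2 * Fgauss κ)
      + 4 * gaussTail (d / √t)) (nhdsWithin 0 (Ioi 0))
      (nhds ((1 - 1 / (2 * (n : ℝ))) * Fgauss κ)) := by
    simpa using (((hratio.pow 2).mul_const (Fgauss κ)).const_mul (1 - 1 / (2 * (n : ℝ)))).add htail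
  have hlim : (1 - 1 / (2 * (n : ℝ))) * Fgauss κ < ε := by
    have h1 : 0 < 1 / (2 * (n : ℝ)) := by positivity
    have h2 : 1 / (2 * (n : ℝ)) ≤ 1 := by rw [div_le_one (by positivity)]; linarith
    nlinarith [mul_le_mul_of_nonneg_left hFκ (sub_nonneg.2 h2), mul_pos h1 hε.1]
  have hev : ∀ᶠ t in nhdsWithin (0 : ℝ) (Ioi 0), κ * √t < d ∧ d / (d - κ * √t) < 1 + √ε ∧
      (1 - 1 / (2 * (n : ℝ))) * ((d / (d - κ * √t)) ^ 2 * Fgauss κ) + 4 * gaussTail (d / √t) < ε ∧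
      4 * gaussTail (d / √t) ≤ ε / 2 ∧ (A + 1) * √t ≤ d / 2 ∧
      2 * (√(2 * n * ε / gaussD (A + 1) 1) + (A + 1)) * √t < √ε / 100 * d := by
    filter_upwards [(hlin κ).eventually_lt_const hd,
      hratio.eventually_lt_const (lt_add_of_pos_right 1 hq), hloss.eventually_lt_const hlim,
      htail.eventually_le_const (half_pos hε.1), (hlin (A + 1)).eventually_le_const (half_pos hd),
      (hlin (2 * (√(2 * n * ε / gaussD (A + 1) 1) + (A + 1)))).eventually_lt_const
        (show (0 : ℝ) < √ε / 100 * d by positivity)] with t h1 h2 h3 h4 h5 h6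
      using ⟨h1, h2, h3, h4, h5, h6⟩
  obtain ⟨t₁, ht₁, hsub⟩ := mem_nhdsGT_iff_exists_Ioo_subset.1 hev
  refine ⟨t₁, ht₁, fun t ht => ?_⟩
  obtain ⟨hδ, hrat, hlt, htl, hAd, hω⟩ := hsub ht
  have ht0 : 0 < t := ht.1
  have hδ0 : 0 < κ * √t := mul_pos hκ (Real.sqrt_pos.2 ht0)
  refine ⟨⟨⟨hδ0, hδ⟩, fun s hs => ⟨(hs.scoreLoss_le hn ht0 hκ hδ).trans_lt hlt,
    hs.rns_eq hn ht0 hδ0 hδ⟩⟩, fun f hf hfin hL => ?_⟩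
  by_cases hR : Rns f = ⊤
  · rw [hR, ENNReal.mul_top (by simpa using by positivity)]
    exact ENNReal.ofReal_lt_top
  refine lt_of_lt_of_le ?_ (mul_le_mul_right
    (le_rns_of_scoreLoss_lt hn hd ht0 hε.1 hA hAt htl hAd hω hf hfin hR hL) _)
  have hd' : 0 < d - κ * √t := sub_pos.2 hδ
  have hgain : 1 + √ε ≤ (1 + 8 * √ε) * (1 - √ε / 100 - 3.5 * √ε) := by nlinarith
  have hc : 0 < 2 * ((n : ℝ) - 1) / t := div_pos (by linarith) ht0
  have hlt' := mul_lt_mul_of_pos_left (hrat.trans_le hgain) hc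
  rw [← ENNReal.ofReal_mul (by positivity),
    show 2 * ((n : ℝ) - 1) * d / (t * (d - κ * √t)) = 2 * ((n : ℝ) - 1) / t * (d / (d - κ * √t)) by
      field_simp,
    show (1 + 8 * √ε) * (2 * ((n : ℝ) - 1) * (1 - √ε / 100 - 3.5 * √ε) / t) =
      2 * ((n : ℝ) - 1) / t * ((1 + 8 * √ε) * (1 - √ε / 100 - 3.5 * √ε)) by ring]
  exact (ENNReal.ofReal_lt_ofReal_iff ((mul_pos hc (by positivity)).trans hlt')).2 hlt'
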